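/- A function u is a fine minimizer in a quasiopen set U if and only if it is both a fine subminimizer and a fine superminimizer in U. -/

import Mathlib

open MeasureTheory Metric Set Filter ENNReal

noncomputable section

variable {X : Type*} [MetricSpace X] [MeasurableSpace X] [BorelSpace X]

/-- A nonconstant compact rectifiable curve, parameterized by arc length
(modelled as a `1`-Lipschitz map on `[0, len]`). -/
structure Curve (X : Type*) [MetricSpace X] where
  len : ℝ
  len_pos : 0 < len
  toFun : ℝ → X
  lip : LipschitzOnWith 1 toFun (Set.Icc 0 len)

/-- The curve lies in the set `E`. -/
def Curve.InSet (γ : Curve X) (E : Set X) : Prop :=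
  ∀ t ∈ Set.Icc (0 : ℝ) γ.len, γ.toFun t ∈ E

/-- Line integral (w.r.t. arc length) of a nonnegative function along a curve. -/
def curveLint (γ : Curve X) (g : X → ℝ≥0∞) : ℝ≥0∞ :=
  ∫⁻ t in Set.Icc (0 : ℝ) γ.len, g (γ.toFun t)

/-- The `p`-modulus of a family of curves. -/
def pMod (μ : Measure X) (p : ℝ) (Γ : Set (Curve X)) : ℝ≥0∞ :=
  ⨅ (ρ : X → ℝ≥0∞) (_ : Measurable ρ) (_ : ∀ γ ∈ Γ, 1 ≤ curveLint γ ρ),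
    ∫⁻ x, ρ x ^ p ∂μ

/-- A property holds for `p`-almost every curve. -/
def AECurve (μ : Measure X) (p : ℝ) (P : Curve X → Prop) : Prop :=
  pMod μ p {γ | ¬ P γ} = 0

/-- `g` is a `p`-weak upper gradient of `f` on `E`. -/
def IsWeakUpperGradientOn (μ : Measure X) (p : ℝ) (f : X → ℝ) (g : X → ℝ≥0∞)
    (E : Set X) : Prop :=
  AECurve (μ.restrict E) p fun γ =>
    γ.InSet E → edist (f (γ.toFun 0)) (f (γ.toFun γ.len)) ≤ curveLint γ g

/-- The Newtonian `p`-energy `∫_E |f|^p dμ + inf_g ∫_E g^p dμ`,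
the `p`-th power of the Newtonian norm. -/
def npEnergy (μ : Measure X) (p : ℝ) (f : X → ℝ) (E : Set X) : ℝ≥0∞ :=
  (∫⁻ x in E, ENNReal.ofReal |f x| ^ p ∂μ) +
    ⨅ (g : X → ℝ≥0∞) (_ : Measurable g) (_ : IsWeakUpperGradientOn μ p f g E),
      ∫⁻ x in E, g x ^ p ∂μ

/-- The Newtonian norm `‖f‖_{N^{1,p}(E)}`. -/
def npNorm (μ : Measure X) (p : ℝ) (f : X → ℝ) (E : Set X) : ℝ≥0∞ :=
  npEnergy μ p f E ^ (1 / p)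

/-- Membership in the Newtonian space `N^{1,p}(E)`. -/
def MemNp (μ : Measure X) (p : ℝ) (f : X → ℝ) (E : Set X) : Prop :=
  Measurable f ∧ npEnergy μ p f E < ⊤

/-- The Sobolev capacity `C_p(E)`. -/
def sobolevCap (μ : Measure X) (p : ℝ) (E : Set X) : ℝ≥0∞ :=
  ⨅ (f : X → ℝ) (_ : MemNp μ p f Set.univ) (_ : ∀ x ∈ E, 1 ≤ f x),
    npEnergy μ p f Set.univ

/-- `f ∈ N^{1,p}_0(A)`: a global Newtonian function vanishing outside `A`. -/
def MemNp0 (μ : Measure X) (p : ℝ) (f : X → ℝ) (A : Set X) : Prop :=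
  MemNp μ p f Set.univ ∧ ∀ x ∉ A, f x = 0

/-- The variational capacity `cap_p(E, A)`. -/
def varCap (μ : Measure X) (p : ℝ) (E A : Set X) : ℝ≥0∞ :=
  ⨅ (f : X → ℝ) (_ : MemNp0 μ p f A) (_ : ∀ x ∈ E, 1 ≤ f x)
    (g : X → ℝ≥0∞) (_ : Measurable g)
    (_ : IsWeakUpperGradientOn μ p f g Set.univ),
    ∫⁻ x, g x ^ p ∂μ

/-- The Wiener-type integrand in the definition of thinness, with the
convention that it equals `1` when `cap_p(B(x,r), B(x,2r)) = 0`. -/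
def thinIntegrand (μ : Measure X) (p : ℝ) (E : Set X) (x : X) (r : ℝ) : ℝ≥0∞ :=
  if varCap μ p (ball x r) (ball x (2 * r)) = 0 then 1
  else (varCap μ p (E ∩ ball x r) (ball x (2 * r)) /
        varCap μ p (ball x r) (ball x (2 * r))) ^ (1 / (p - 1))

/-- `E` is thin at `x`:
`∫_0^1 (cap_p(E∩B(x,r),B(x,2r))/cap_p(B(x,r),B(x,2r)))^{1/(p-1)} dr/r < ∞`. -/
def Thin (μ : Measure X) (p : ℝ) (E : Set X) (x : X) : Prop :=
  ∫⁻ r in Set.Ioo (0 : ℝ) 1, thinIntegrand μ p E x r / ENNReal.ofReal r < ⊤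

/-- A set is finely open if its complement is thin at each of its points. -/
def FinelyOpen (μ : Measure X) (p : ℝ) (V : Set X) : Prop :=
  ∀ x ∈ V, Thin μ p Vᶜ x

/-- A set `U` is quasiopen if for every `ε > 0` there is an open set `G`
with `C_p(G) < ε` such that `G ∪ U` is open. -/
def Quasiopen (μ : Measure X) (p : ℝ) (U : Set X) : Prop :=
  ∀ ε : ℝ≥0∞, 0 < ε → ∃ G : Set X, IsOpen G ∧ sobolevCap μ p G < ε ∧ IsOpen (G ∪ U)

/-- The fine topology: the topology generated by the finely open sets. -/
def fineTopology (μ : Measure X) (p : ℝ) : TopologicalSpace X :=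
  TopologicalSpace.generateFrom {V | FinelyOpen μ p V}

/-- `A` is a `p`-strict subset of `E`. -/
def PStrictSubset (μ : Measure X) (p : ℝ) (A E : Set X) : Prop :=
  A ⊆ E ∧ ∃ η : X → ℝ, MemNp0 μ p η E ∧ ∀ x ∈ A, η x = 1

/-- `V` is a finely open `p`-strict subset of `U` with compact closure
contained in `U` (written `V ⋐ U`). -/
def GoodSubset (μ : Measure X) (p : ℝ) (V U : Set X) : Prop :=
  FinelyOpen μ p V ∧ PStrictSubset μ p V U ∧ IsCompact (closure V) ∧ closure V ⊆ U

/-- The fine local Newtonian space `N^{1,p}_{fine-loc}(U)`. -/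
def MemNpFineLoc (μ : Measure X) (p : ℝ) (f : X → ℝ) (U : Set X) : Prop :=
  ∀ V : Set X, GoodSubset μ p V U → MemNp μ p f V

/-- The local Newtonian space `N^{1,p}_loc(G)`. -/
def MemNpLoc (μ : Measure X) (p : ℝ) (f : X → ℝ) (G : Set X) : Prop :=
  ∀ x ∈ G, ∃ r : ℝ, 0 < r ∧ MemNp μ p f (ball x r ∩ G)

/-- `∫_S g_u^p dμ`, where `g_u` is the minimal `p`-weak upper gradient of `u`
taken with respect to `U`, expressed as the infimum of the energies of all
`p`-weak upper gradients of `u` on `U`. -/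
def fineEnergy (μ : Measure X) (p : ℝ) (u : X → ℝ) (U S : Set X) : ℝ≥0∞ :=
  ⨅ (g : X → ℝ≥0∞) (_ : Measurable g) (_ : IsWeakUpperGradientOn μ p u g U),
    ∫⁻ x in S, g x ^ p ∂μ

/-- `u` is a fine superminimizer in `U`. -/
def FineSuperminimizer (μ : Measure X) (p : ℝ) (u : X → ℝ) (U : Set X) : Prop :=
  MemNpFineLoc μ p u U ∧
    ∀ V : Set X, GoodSubset μ p V U →
      ∀ φ : X → ℝ, MemNp0 μ p φ V → (∀ x, 0 ≤ φ x) →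
        fineEnergy μ p u U V ≤ fineEnergy μ p (fun x => u x + φ x) U V

/-- `u` is a fine minimizer in `U`. -/
def FineMinimizer (μ : Measure X) (p : ℝ) (u : X → ℝ) (U : Set X) : Prop :=
  MemNpFineLoc μ p u U ∧
    ∀ V : Set X, GoodSubset μ p V U →
      ∀ φ : X → ℝ, MemNp0 μ p φ V →
        fineEnergy μ p u U V ≤ fineEnergy μ p (fun x => u x + φ x) U V

/-- `u` is a fine subminimizer in `U` if `-u` is a fine superminimizer. -/
def FineSubminimizer (μ : Measure X) (p : ℝ) (u : X → ℝ) (U : Set X) : Prop :=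
  FineSuperminimizer μ p (fun x => -u x) U

/-- A doubling measure which is positive and finite on balls. -/
def DoublingMeasure (μ : Measure X) : Prop :=
  (∀ (x : X) (r : ℝ), 0 < r → 0 < μ (ball x r) ∧ μ (ball x r) < ⊤) ∧
    ∃ C : ℝ≥0∞, C < ⊤ ∧
      ∀ (x : X) (r : ℝ), 0 < r → μ (ball x (2 * r)) ≤ C * μ (ball x r)

/-- `X` supports a `p`-Poincaré inequality. -/
def PoincareInequality (μ : Measure X) (p : ℝ) : Prop :=
  ∃ C : ℝ≥0∞, 0 < C ∧ ∃ lam : ℝ, 1 ≤ lam ∧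
    ∀ (x : X) (r : ℝ), 0 < r → ∀ (f : X → ℝ) (g : X → ℝ≥0∞),
      Measurable f → Measurable g → IsWeakUpperGradientOn μ p f g Set.univ →
      (μ (ball x r))⁻¹ *
          ∫⁻ y in ball x r, ENNReal.ofReal |f y - ⨍ z in ball x r, f z ∂μ| ∂μ ≤
        C * ENNReal.ofReal (2 * r) *
          ((μ (ball x (lam * r)))⁻¹ * ∫⁻ y in ball x (lam * r), g y ^ p ∂μ) ^ (1 / p)

theorem AbsolutelyContinuousOnInterval.of_dist_le {f F : ℝ → ℝ} {a b : ℝ}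
    (hF : AbsolutelyContinuousOnInterval F a b)
    (h : ∀ s ∈ uIcc a b, ∀ t ∈ uIcc a b, dist (f s) (f t) ≤ dist (F s) (F t)) :
    AbsolutelyContinuousOnInterval f a b := by
  rw [absolutelyContinuousOnInterval_iff] at hF ⊢
  intro ε hε
  obtain ⟨δ, hδ, H⟩ := hF ε hε
  refine ⟨δ, hδ, fun E hE hlt => (Finset.sum_le_sum fun i hi => ?_).trans_lt (H E hE hlt)⟩
  exact h _ (hE.1 i hi).1 _ (hE.1 i hi).2

/-- A function whose increments are controlled by the integral of `A` on subintervals is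
absolutely continuous, with derivative bounded by `A` almost everywhere. -/
theorem ac_and_ae_enorm_deriv_le {L : ℝ} (hL : 0 ≤ L) {a : ℝ → ℝ} {A : ℝ → ℝ≥0∞}
    (hA : AEMeasurable A (volume.restrict (Icc 0 L))) (hfin : ∫⁻ t in Icc 0 L, A t ≠ ⊤)
    (ha : ∀ s t, 0 ≤ s → s ≤ t → t ≤ L → edist (a s) (a t) ≤ ∫⁻ r in Icc s t, A r) :
    AbsolutelyContinuousOnInterval a 0 L ∧
      ∀ᵐ t, t ∈ Ioo 0 L → DifferentiableAt ℝ a t ∧ ‖deriv a t‖ₑ ≤ A t := by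
  have hint : IntegrableOn (fun t => (A t).toReal) (Icc 0 L) :=
    integrable_toReal_of_lintegral_ne_top hA hfin
  have hii : IntervalIntegrable (fun t => (A t).toReal) volume 0 L :=
    (intervalIntegrable_iff_integrableOn_Icc_of_le hL).2 hint
  have hlt : ∀ᵐ t ∂volume.restrict (Icc 0 L), A t < ⊤ := ae_lt_top' hA hfin
  set F : ℝ → ℝ := fun t => ∫ x in (0 : ℝ)..t, (A x).toReal with hF
  have hsub : ∀ s t, 0 ≤ s → s ≤ t → t ≤ L → |a t - a s| ≤ F t - F s := by
    intro s t hs hst ht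
    have hss : Icc s t ⊆ Icc 0 L := Icc_subset_Icc hs ht
    have h1 : F t - F s = (∫⁻ r in Icc s t, A r).toReal := by
      have e : F t - F s = ∫ x in s..t, (A x).toReal := by
        refine intervalIntegral.integral_interval_sub_left ?_ ?_
        · exact hii.mono_set (by
            rw [uIcc_of_le (hs.trans hst), uIcc_of_le hL]; exact Icc_subset_Icc le_rfl ht)
        · exact hii.mono_set (by
            rw [uIcc_of_le hs, uIcc_of_le hL]; exact Icc_subset_Icc le_rfl (hst.trans ht))
      rw [e, intervalIntegral.integral_of_le hst, ← integral_Icc_eq_integral_Ioc,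
        integral_toReal (hA.mono_measure (Measure.restrict_mono hss le_rfl))]
      exact ae_mono (Measure.restrict_mono hss le_rfl) hlt
    have h2 : ∫⁻ r in Icc s t, A r ≠ ⊤ := ne_top_of_le_ne_top hfin (lintegral_mono_set hss)
    rw [h1, ← Real.dist_eq, dist_comm, dist_edist]
    exact ENNReal.toReal_mono h2 (ha s t hs hst ht)
  have hFac : AbsolutelyContinuousOnInterval F 0 L :=
    hii.absolutelyContinuousOnInterval_intervalIntegral (by simp)
  have hac : AbsolutelyContinuousOnInterval a 0 L := by
    refine hFac.of_dist_le ?_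
    rw [uIcc_of_le hL]
    intro s hs t ht
    rcases le_total s t with h | h
    · rw [dist_comm, dist_comm (F s), Real.dist_eq, Real.dist_eq]
      exact (hsub s t hs.1 h ht.2).trans (le_abs_self _)
    · rw [Real.dist_eq, Real.dist_eq]
      exact (hsub t s ht.1 h hs.2).trans (le_abs_self _)
  refine ⟨hac, ?_⟩
  filter_upwards [hac.ae_differentiableAt, hii.ae_hasDerivAt_integral] with t h1 h2 ht
  have htI : t ∈ uIcc 0 L := by rw [uIcc_of_le hL]; exact Ioo_subset_Icc_self ht
  have hd := h1 htI
  have hFd : HasDerivAt F (A t).toReal t := h2 htI 0 (by simp)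
  refine ⟨hd, ?_⟩
  have nonneg : ∀ (f : ℝ → ℝ) (f' : ℝ), HasDerivAt f f' t → MonotoneOn f (Icc 0 L) → 0 ≤ f' := by
    intro f f' hf hm
    rw [← hf.hasDerivWithinAt.derivWithin
      (uniqueDiffOn_Icc (ht.1.trans ht.2) t (Ioo_subset_Icc_self ht))]
    exact hm.derivWithin_nonneg
  have k1 := nonneg _ _ (hFd.sub hd.hasDerivAt) (by
    intro x hx y hy hxy
    have := abs_le.1 (hsub x y hx.1 hxy hy.2)
    simp only [Pi.sub_apply]; linarith)
  have k2 := nonneg _ _ (hFd.add hd.hasDerivAt) (by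
    intro x hx y hy hxy
    have := abs_le.1 (hsub x y hx.1 hxy hy.2)
    simp only [Pi.add_apply]; linarith)
  have k3 : |deriv a t| ≤ (A t).toReal := abs_le.2 ⟨by linarith, by linarith⟩
  rw [Real.enorm_eq_ofReal_abs]
  exact ENNReal.ofReal_le_of_le_toReal k3

theorem deriv_eq_of_le_of_eq {f g : ℝ → ℝ} {t : ℝ} (hle : ∀ s, f s ≤ g s) (heq : f t = g t)
    (hf : DifferentiableAt ℝ f t) (hg : DifferentiableAt ℝ g t) : deriv g t = deriv f t := by
  have hmin : IsLocalMin (g - f) t := Eventually.of_forall fun s => by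
    simp only [Pi.sub_apply, heq, sub_self]; linarith [hle s]
  have := hmin.hasDerivAt_eq_zero (hg.hasDerivAt.sub hf.hasDerivAt)
  linarith

/-- The increment of `max a b` is controlled by the integral of the control of `a` where
`b ≤ a` and that of `b` elsewhere. -/
theorem edist_max_le_lintegral_ite {L : ℝ} (hL : 0 ≤ L) {a b : ℝ → ℝ} {A B : ℝ → ℝ≥0∞}
    (hA : AEMeasurable A (volume.restrict (Icc 0 L))) (hAfin : ∫⁻ t in Icc 0 L, A t ≠ ⊤)
    (ha : ∀ s t, 0 ≤ s → s ≤ t → t ≤ L → edist (a s) (a t) ≤ ∫⁻ r in Icc s t, A r)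
    (hB : AEMeasurable B (volume.restrict (Icc 0 L))) (hBfin : ∫⁻ t in Icc 0 L, B t ≠ ⊤)
    (hb : ∀ s t, 0 ≤ s → s ≤ t → t ≤ L → edist (b s) (b t) ≤ ∫⁻ r in Icc s t, B r) :
    edist (max (a 0) (b 0)) (max (a L) (b L)) ≤
      ∫⁻ t in Icc 0 L, if b t ≤ a t then A t else B t := by
  obtain ⟨-, haD⟩ := ac_and_ae_enorm_deriv_le hL hA hAfin ha
  obtain ⟨-, hbD⟩ := ac_and_ae_enorm_deriv_le hL hB hBfin hb
  have hmAB : ∀ s t, 0 ≤ s → s ≤ t → t ≤ L →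
      edist (max (a s) (b s)) (max (a t) (b t)) ≤ ∫⁻ r in Icc s t, (A r + B r) := by
    intro s t hs hst ht
    have hA' : AEMeasurable A (volume.restrict (Icc s t)) :=
      hA.mono_measure (Measure.restrict_mono (Icc_subset_Icc hs ht) le_rfl)
    rw [lintegral_add_left' hA']
    refine le_trans ?_ (add_le_add (ha s t hs hst ht) (hb s t hs hst ht))
    simp only [edist_dist, Real.dist_eq]
    rw [← ENNReal.ofReal_add (abs_nonneg _) (abs_nonneg _)]
    refine ENNReal.ofReal_le_ofReal ((abs_max_sub_max_le_max _ _ _ _).trans ?_)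
    exact max_le_add_of_nonneg (abs_nonneg _) (abs_nonneg _)
  have hABfin : ∫⁻ t in Icc 0 L, (A t + B t) ≠ ⊤ := by
    rw [lintegral_add_left' hA]; exact ENNReal.add_ne_top.2 ⟨hAfin, hBfin⟩
  obtain ⟨hm, hmD⟩ := ac_and_ae_enorm_deriv_le (a := fun t => max (a t) (b t)) hL
    (hA.add hB) hABfin hmAB
  have key := hm.integral_deriv_eq_sub
  rw [edist_comm, edist_eq_enorm_sub, ← key, intervalIntegral.integral_of_le hL,
    integral_Ioc_eq_integral_Ioo, ← restrict_Ioo_eq_restrict_Icc]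
  refine (enorm_integral_le_lintegral_enorm _).trans (lintegral_mono_ae ?_)
  rw [ae_restrict_iff' measurableSet_Ioo]
  filter_upwards [haD, hbD, hmD] with t h1 h2 h3 ht
  obtain ⟨a1, a2⟩ := h1 ht
  obtain ⟨b1, b2⟩ := h2 ht
  obtain ⟨m1, -⟩ := h3 ht
  split_ifs with hab
  · rwa [deriv_eq_of_le_of_eq (fun s => le_max_left (a s) (b s)) (max_eq_left hab).symm a1 m1]
  · rwa [deriv_eq_of_le_of_eq (fun s => le_max_right (a s) (b s))
      (max_eq_right (le_of_not_ge hab)).symm b1 m1]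

/-- The restriction of a curve to a nondegenerate subinterval. -/
def Curve.subcurve (γ : Curve X) (s t : ℝ) (hs : 0 ≤ s) (hst : s < t) (ht : t ≤ γ.len) :
    Curve X where
  len := t - s
  len_pos := sub_pos.2 hst
  toFun r := γ.toFun (s + r)
  lip := by
    intro x hx y hy
    have := γ.lip (x := s + x) ⟨by linarith [hx.1], by linarith [hx.2]⟩
      (y := s + y) ⟨by linarith [hy.1], by linarith [hy.2]⟩
    simpa using this


theorem curveLint_subcurve (γ : Curve X) {s t : ℝ} (hs : 0 ≤ s) (hst : s < t) (ht : t ≤ γ.len)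
    (g : X → ℝ≥0∞) :
    curveLint (γ.subcurve s t hs hst ht) g = ∫⁻ r in Icc s t, g (γ.toFun r) := by
  have := (measurePreserving_add_left volume s).setLIntegral_comp_preimage_emb
    (MeasurableEquiv.addLeft s).measurableEmbedding (fun r => g (γ.toFun r)) (Icc s t)
  simpa [curveLint, Curve.subcurve] using this

theorem Curve.InSet.subcurve {γ : Curve X} {E : Set X} (h : γ.InSet E) {s t : ℝ} (hs : 0 ≤ s)
    (hst : s < t) (ht : t ≤ γ.len) : (γ.subcurve s t hs hst ht).InSet E := by
  intro r hr
  have hr2 : r ≤ t - s := hr.2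
  exact h _ ⟨by linarith [hr.1], by linarith⟩

theorem Curve.aemeasurable_comp (γ : Curve X) {g : X → ℝ≥0∞} (hg : Measurable g) :
    AEMeasurable (fun t => g (γ.toFun t)) (volume.restrict (Icc 0 γ.len)) :=
  hg.comp_aemeasurable (γ.lip.continuousOn.aemeasurable measurableSet_Icc)

theorem pMod_le_of_forall_exists {μ : Measure X} {p : ℝ} {Γ Γ' : Set (Curve X)}
    (h : ∀ γ ∈ Γ, ∃ γ' ∈ Γ', ∀ ρ, curveLint γ' ρ ≤ curveLint γ ρ) :
    pMod μ p Γ ≤ pMod μ p Γ' := by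
  refine le_iInf fun ρ => le_iInf fun hρ => le_iInf fun hadm => ?_
  refine iInf_le_of_le ρ (iInf_le_of_le hρ (iInf_le_of_le (fun γ hγ => ?_) le_rfl))
  obtain ⟨γ', hγ', hle⟩ := h γ hγ
  exact (hadm γ' hγ').trans (hle ρ)

theorem pMod_mono_measure {μ ν : Measure X} (hνμ : ν ≤ μ) (p : ℝ) (Γ : Set (Curve X)) :
    pMod ν p Γ ≤ pMod μ p Γ :=
  iInf_mono fun _ => iInf_mono fun _ => iInf_mono fun _ => lintegral_mono' hνμ le_rfl

theorem pMod_union_le {μ : Measure X} {p : ℝ} (Γ Γ' : Set (Curve X)) :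
    pMod μ p (Γ ∪ Γ') ≤ pMod μ p Γ + pMod μ p Γ' := by
  simp only [pMod, ENNReal.iInf_add, ENNReal.add_iInf]
  refine le_iInf fun σ => le_iInf fun hσ => le_iInf fun hadm' => le_iInf fun ρ => le_iInf fun hρ =>
    le_iInf fun hadm => ?_
  rw [← lintegral_add_left (hρ.pow_const p)]
  refine iInf_le_of_le (fun x => max (ρ x) (σ x)) (iInf_le_of_le (hρ.max hσ)
    (iInf_le_of_le ?_ (lintegral_mono fun x => ?_)))
  · rintro γ (hγ | hγ)
    · exact (hadm γ hγ).trans (lintegral_mono fun t => le_max_left _ _)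
    · exact (hadm' γ hγ).trans (lintegral_mono fun t => le_max_right _ _)
  · dsimp only
    rcases le_total (ρ x) (σ x) with h | h
    · rw [max_eq_right h]; exact le_add_self
    · rw [max_eq_left h]; exact le_self_add

theorem pMod_curveLint_eq_top {μ : Measure X} {p : ℝ} (hp : 0 < p) {f : X → ℝ≥0∞}
    (hf : Measurable f) (hfin : ∫⁻ x, f x ^ p ∂μ ≠ ⊤) :
    pMod μ p {γ | curveLint γ f = ⊤} = 0 := by
  refine le_antisymm (ge_of_tendsto' (x := atTop) (f := fun n : ℕ =>
    ((n : ℝ≥0∞) + 1)⁻¹ ^ p * ∫⁻ x, f x ^ p ∂μ) ?_ fun n => ?_) bot_le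
  · have h1 : Tendsto (fun n : ℕ => ((n : ℝ≥0∞) + 1)⁻¹) atTop (nhds 0) := by
      have := (tendsto_add_atTop_iff_nat 1).2 ENNReal.tendsto_inv_nat_nhds_zero
      simpa using this
    have h2 := (ENNReal.continuous_rpow_const (y := p)).tendsto (0 : ℝ≥0∞) |>.comp h1
    rw [ENNReal.zero_rpow_of_pos hp] at h2
    simpa using ENNReal.Tendsto.mul_const h2 (Or.inr hfin)
  · have hc0 : ((n : ℝ≥0∞) + 1)⁻¹ ≠ 0 := by simp
    refine iInf_le_of_le (fun x => ((n : ℝ≥0∞) + 1)⁻¹ * f x)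
      (iInf_le_of_le (hf.const_mul _) (iInf_le_of_le ?_ ?_))
    · intro γ hγ
      have hγ' : ∫⁻ t in Icc 0 γ.len, f (γ.toFun t) = ⊤ := hγ
      rw [curveLint, lintegral_const_mul'' _ (γ.aemeasurable_comp hf), hγ', ENNReal.mul_top hc0]
      exact le_top
    · rw [← lintegral_const_mul _ (hf.pow_const p)]
      exact lintegral_mono fun x => (ENNReal.mul_rpow_of_nonneg _ _ hp.le).le

theorem AECurve.mono {μ : Measure X} {p : ℝ} {P Q : Curve X → Prop} (h : AECurve μ p P)
    (hPQ : ∀ γ, P γ → Q γ) : AECurve μ p Q :=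
  le_antisymm ((pMod_le_of_forall_exists fun γ (hγ : ¬ Q γ) =>
    ⟨γ, fun hP => hγ (hPQ γ hP), fun _ => le_rfl⟩).trans h.le) bot_le

theorem AECurve.mono_measure {μ ν : Measure X} {p : ℝ} {P : Curve X → Prop}
    (h : AECurve μ p P) (hνμ : ν ≤ μ) : AECurve ν p P :=
  le_antisymm ((pMod_mono_measure hνμ p _).trans h.le) bot_le

theorem AECurve.and {μ : Measure X} {p : ℝ} {P Q : Curve X → Prop}
    (hP : AECurve μ p P) (hQ : AECurve μ p Q) : AECurve μ p fun γ => P γ ∧ Q γ := by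
  have hsub : {γ : Curve X | ¬ (P γ ∧ Q γ)} = {γ | ¬ P γ} ∪ {γ | ¬ Q γ} := by
    ext γ; simp only [mem_ofPred_eq, mem_union]; tauto
  refine le_antisymm ?_ bot_le
  rw [hsub]
  refine (pMod_union_le _ _).trans ?_
  rw [show pMod μ p {γ | ¬ P γ} = 0 from hP, show pMod μ p {γ | ¬ Q γ} = 0 from hQ, add_zero]

/-- The upper gradient inequality holds on all subcurves of almost every curve. -/
theorem IsWeakUpperGradientOn.aeCurve_subcurve {μ : Measure X} {p : ℝ} {f : X → ℝ}
    {g : X → ℝ≥0∞} {E : Set X} (h : IsWeakUpperGradientOn μ p f g E) :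
    AECurve (μ.restrict E) p fun γ => γ.InSet E → ∀ s t, 0 ≤ s → s ≤ t → t ≤ γ.len →
      edist (f (γ.toFun s)) (f (γ.toFun t)) ≤ ∫⁻ r in Icc s t, g (γ.toFun r) := by
  refine le_antisymm ((pMod_le_of_forall_exists fun γ hγ => ?_).trans h.le) bot_le
  simp only [mem_ofPred_eq, not_forall] at hγ
  obtain ⟨hin, s, t, hs, hst, ht, hlt⟩ := hγ
  rcases hst.eq_or_lt with rfl | hst
  · simp at hlt
  refine ⟨γ.subcurve s t hs hst ht, fun hc => hlt ?_, fun ρ => ?_⟩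
  · have := hc (hin.subcurve hs hst ht)
    rw [curveLint_subcurve] at this
    simpa [Curve.subcurve] using this
  · rw [curveLint_subcurve]
    exact lintegral_mono_set (Icc_subset_Icc hs ht)

theorem IsWeakUpperGradientOn.of_edist_le {μ : Measure X} {p : ℝ} {f f' : X → ℝ}
    {g : X → ℝ≥0∞} {E : Set X} (h : IsWeakUpperGradientOn μ p f g E)
    (hle : ∀ x y, edist (f' x) (f' y) ≤ edist (f x) (f y)) :
    IsWeakUpperGradientOn μ p f' g E :=
  AECurve.mono h fun _ hγ hin => (hle _ _).trans (hγ hin)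

theorem IsWeakUpperGradientOn.neg {μ : Measure X} {p : ℝ} {f : X → ℝ}
    {g : X → ℝ≥0∞} {E : Set X} (h : IsWeakUpperGradientOn μ p f g E) :
    IsWeakUpperGradientOn μ p (fun x => -f x) g E :=
  h.of_edist_le fun _ _ => by rw [edist_neg_neg]

theorem IsWeakUpperGradientOn.mono_gradient {μ : Measure X} {p : ℝ} {f : X → ℝ}
    {g g' : X → ℝ≥0∞} {E : Set X} (h : IsWeakUpperGradientOn μ p f g E) (hle : ∀ x, g x ≤ g' x) :
    IsWeakUpperGradientOn μ p f g' E :=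
  AECurve.mono h fun _ hγ hin => (hγ hin).trans (lintegral_mono fun _ => hle _)

theorem IsWeakUpperGradientOn.mono_set {μ : Measure X} {p : ℝ} {f : X → ℝ}
    {g : X → ℝ≥0∞} {E E' : Set X} (h : IsWeakUpperGradientOn μ p f g E) (hE : E' ⊆ E) :
    IsWeakUpperGradientOn μ p f g E' := by
  have h' := AECurve.mono_measure h (Measure.restrict_mono hE le_rfl)
  exact AECurve.mono h' fun _ hγ hin => hγ fun t ht => hE (hin t ht)

theorem IsWeakUpperGradientOn.sub {μ : Measure X} {p : ℝ} {f₁ f₂ : X → ℝ}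
    {g₁ g₂ : X → ℝ≥0∞} {E : Set X} (hg₁ : Measurable g₁)
    (h₁ : IsWeakUpperGradientOn μ p f₁ g₁ E) (h₂ : IsWeakUpperGradientOn μ p f₂ g₂ E) :
    IsWeakUpperGradientOn μ p (fun x => f₁ x - f₂ x) (fun x => g₁ x + g₂ x) E := by
  refine AECurve.mono (AECurve.and h₁ h₂) fun γ hγ hin => ?_
  rw [curveLint, lintegral_add_left' (γ.aemeasurable_comp hg₁)]
  refine le_trans ?_ (add_le_add (hγ.1 hin) (hγ.2 hin))
  simp only [sub_eq_add_neg]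
  exact (edist_add_add_le _ _ _ _).trans (add_le_add le_rfl (edist_neg_neg _ _).le)

/-- Gluing: `g₁` on `{u₂ ≤ u₁}` and `g₂` elsewhere is a weak upper gradient of the maximum,
provided that it controls `g₁` and `g₂` up to an `L^p` function. -/
theorem IsWeakUpperGradientOn.max {μ : Measure X} {p : ℝ} (hp : 0 < p) {u₁ u₂ : X → ℝ}
    {g₁ g₂ f h : X → ℝ≥0∞} {E : Set X} (hg₁ : Measurable g₁) (hg₂ : Measurable g₂)
    (h₁ : IsWeakUpperGradientOn μ p u₁ g₁ E) (h₂ : IsWeakUpperGradientOn μ p u₂ g₂ E)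
    (hf : Measurable f) (hfin : ∫⁻ x, f x ^ p ∂μ ≠ ⊤)
    (hle₁ : ∀ x, g₁ x ≤ f x + h x) (hle₂ : ∀ x, g₂ x ≤ f x + h x)
    (heq₁ : ∀ x, u₂ x ≤ u₁ x → h x = g₁ x) (heq₂ : ∀ x, u₁ x < u₂ x → h x = g₂ x) :
    IsWeakUpperGradientOn μ p (fun x => max (u₁ x) (u₂ x)) h E := by
  have hae : AECurve (μ.restrict E) p fun γ => curveLint γ f ≠ ⊤ := by
    have := pMod_curveLint_eq_top hp hf
      (ne_top_of_le_ne_top hfin (lintegral_mono' (Measure.restrict_le_self (s := E)) le_rfl))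
    simpa only [AECurve, ne_eq, not_not] using this
  refine AECurve.mono (AECurve.and hae
    (AECurve.and h₁.aeCurve_subcurve h₂.aeCurve_subcurve)) ?_
  rintro γ ⟨hγf, hγ₁, hγ₂⟩ hin
  by_cases htop : curveLint γ h = ⊤
  · rw [htop]; exact le_top
  have hsum : ∫⁻ t in Icc 0 γ.len, (f (γ.toFun t) + h (γ.toFun t)) ≠ ⊤ := by
    rw [lintegral_add_left' (γ.aemeasurable_comp hf)]
    exact ENNReal.add_ne_top.2 ⟨hγf, htop⟩
  refine (edist_max_le_lintegral_ite γ.len_pos.le (γ.aemeasurable_comp hg₁)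
    (ne_top_of_le_ne_top hsum (lintegral_mono fun t => hle₁ _)) (hγ₁ hin)
    (γ.aemeasurable_comp hg₂)
    (ne_top_of_le_ne_top hsum (lintegral_mono fun t => hle₂ _)) (hγ₂ hin)).trans ?_
  refine lintegral_mono fun t => ?_
  dsimp only
  split_ifs with hc
  · exact (heq₁ _ hc).ge
  · exact (heq₂ _ (not_le.1 hc)).ge

theorem fineEnergy_le {μ : Measure X} {p : ℝ} {u : X → ℝ} {g : X → ℝ≥0∞} {U : Set X}
    (hg : Measurable g) (hw : IsWeakUpperGradientOn μ p u g U) (S : Set X) :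
    fineEnergy μ p u U S ≤ ∫⁻ x in S, g x ^ p ∂μ :=
  iInf_le_of_le g (iInf_le_of_le hg (iInf_le_of_le hw le_rfl))

theorem fineEnergy_neg (μ : Measure X) (p : ℝ) (u : X → ℝ) (U S : Set X) :
    fineEnergy μ p (fun x => -u x) U S = fineEnergy μ p u U S := by
  have h : ∀ w : X → ℝ, fineEnergy μ p (fun x => -w x) U S ≤ fineEnergy μ p w U S := fun w =>
    le_iInf fun g => le_iInf fun hg => le_iInf fun hw => fineEnergy_le hg hw.neg S
  refine le_antisymm (h u) ?_
  simpa only [neg_neg] using h fun x => -u x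

theorem npEnergy_le_of_contraction {μ : Measure X} {p : ℝ} (hp : 0 ≤ p) {f f' : X → ℝ} {E : Set X}
    (habs : ∀ x, |f' x| ≤ |f x|) (hle : ∀ x y, edist (f' x) (f' y) ≤ edist (f x) (f y)) :
    npEnergy μ p f' E ≤ npEnergy μ p f E := by
  refine add_le_add (lintegral_mono fun x => ENNReal.rpow_le_rpow
    (ENNReal.ofReal_le_ofReal (habs x)) hp) ?_
  exact le_iInf fun g => le_iInf fun hg => le_iInf fun hw =>
    iInf_le_of_le g (iInf_le_of_le hg (iInf_le_of_le (hw.of_edist_le hle) le_rfl))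

theorem MemNp.neg {μ : Measure X} {p : ℝ} (hp : 0 ≤ p) {f : X → ℝ} {E : Set X}
    (h : MemNp μ p f E) : MemNp μ p (fun x => -f x) E :=
  ⟨h.1.neg, (npEnergy_le_of_contraction hp (fun x => (abs_neg _).le)
    fun x y => by rw [edist_neg_neg]).trans_lt h.2⟩

theorem MemNp0.neg {μ : Measure X} {p : ℝ} (hp : 0 ≤ p) {f : X → ℝ} {A : Set X}
    (h : MemNp0 μ p f A) : MemNp0 μ p (fun x => -f x) A :=
  ⟨h.1.neg hp, fun x hx => by simp [h.2 x hx]⟩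

theorem MemNp0.max_zero {μ : Measure X} {p : ℝ} (hp : 0 ≤ p) {f : X → ℝ} {A : Set X}
    (h : MemNp0 μ p f A) : MemNp0 μ p (fun x => max (f x) 0) A := by
  refine ⟨⟨h.1.1.max measurable_const, (npEnergy_le_of_contraction hp (fun x => ?_)
    fun x y => ?_).trans_lt h.1.2⟩, fun x hx => by simp [h.2 x hx]⟩
  · rw [abs_of_nonneg (le_max_right _ _)]
    exact max_le (le_abs_self _) (abs_nonneg _)
  · rw [edist_dist, edist_dist, Real.dist_eq, Real.dist_eq]
    refine ENNReal.ofReal_le_ofReal ((abs_max_sub_max_le_max _ _ _ _).trans ?_)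
    simp

theorem MemNp.exists_weakUpperGradient {μ : Measure X} {p : ℝ} {f : X → ℝ} {E : Set X}
    (h : MemNp μ p f E) : ∃ g : X → ℝ≥0∞, Measurable g ∧ IsWeakUpperGradientOn μ p f g E ∧
      ∫⁻ x in E, g x ^ p ∂μ < ⊤ := by
  have h2 := (ENNReal.add_lt_top.1 h.2).2
  simp only [iInf_lt_iff] at h2
  obtain ⟨g, hg, hw, hlt⟩ := h2
  exact ⟨g, hg, hw, hlt⟩

/-- Subtracting a function of finite global energy preserves finiteness of the energy. -/
theorem fineEnergy_sub_lt_top {μ : Measure X} {p : ℝ} (hp : 1 ≤ p) {v φ : X → ℝ} {U V : Set X}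
    (hφ : MemNp μ p φ univ) (hv : fineEnergy μ p v U V < ⊤) :
    fineEnergy μ p (fun x => v x - φ x) U V < ⊤ := by
  simp only [fineEnergy, iInf_lt_iff] at hv
  obtain ⟨g, hg, hw, hlt⟩ := hv
  obtain ⟨g', hg', hw', hlt'⟩ := hφ.exists_weakUpperGradient
  refine lt_of_le_of_lt (fineEnergy_le (hg.add hg')
    (IsWeakUpperGradientOn.sub hg hw (hw'.mono_set (subset_univ U))) V) ?_
  refine ENNReal.lintegral_rpow_add_lt_top_of_lintegral_rpow_lt_top hg.aemeasurable hlt ?_ hp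
  exact (lintegral_mono_set (subset_univ V)).trans_lt hlt'

/-- Strong subadditivity of the energy. -/
theorem fineEnergy_max_add_min_le {μ : Measure X} {p : ℝ} (hp : 0 < p) {u v : X → ℝ} {U V : Set X}
    (hV : μ V ≠ ⊤) (hS : MeasurableSet {x | v x ≤ u x}) :
    fineEnergy μ p (fun x => max (u x) (v x)) U V + fineEnergy μ p (fun x => min (u x) (v x)) U V ≤
      fineEnergy μ p u U V + fineEnergy μ p v U V := by
  classical
  rw [← fineEnergy_neg μ p fun x => min (u x) (v x)]
  simp only [← max_neg_neg]
  conv_rhs => simp only [fineEnergy, ENNReal.iInf_add, ENNReal.add_iInf]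
  refine le_iInf fun g₂ => le_iInf fun hg₂ => le_iInf fun hw₂ => le_iInf fun g₁ =>
    le_iInf fun hg₁ => le_iInf fun hw₁ => ?_
  by_cases ht₁ : ∫⁻ x in V, g₁ x ^ p ∂μ = ⊤
  · simp [ht₁]
  by_cases ht₂ : ∫⁻ x in V, g₂ x ^ p ∂μ = ⊤
  · simp [ht₂]
  set M := toMeasurable μ V
  have hM : MeasurableSet M := measurableSet_toMeasurable _ _
  have hMV : μ.restrict M = μ.restrict V := Measure.restrict_toMeasurable hV
  set S := {x | v x ≤ u x}
  set T : X → ℝ≥0∞ := M.piecewise 0 (fun _ => ⊤)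
  have hT : Measurable T := Measurable.piecewise hM measurable_const measurable_const
  set f : X → ℝ≥0∞ := M.indicator fun x => max (g₁ x) (g₂ x)
  have hf : Measurable f := (hg₁.max hg₂).indicator hM
  have hfin : ∫⁻ x, f x ^ p ∂μ ≠ ⊤ := by
    have hle : ∫⁻ x, f x ^ p ∂μ ≤ ∫⁻ x in M, (g₁ x ^ p + g₂ x ^ p) ∂μ := by
      rw [← lintegral_indicator hM]
      refine lintegral_mono fun x => ?_
      by_cases hx : x ∈ M
      · simp only [f, indicator_of_mem hx]
        rcases le_total (g₁ x) (g₂ x) with h | h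
        · rw [max_eq_right h]; exact le_add_self
        · rw [max_eq_left h]; exact le_self_add
      · simp [f, indicator_of_notMem hx, hp]
    refine ne_top_of_le_ne_top ?_ hle
    rw [hMV, lintegral_add_left (hg₁.pow_const p)]
    exact ENNReal.add_ne_top.2 ⟨ht₁, ht₂⟩
  set G₁ : X → ℝ≥0∞ := fun x => g₁ x + T x
  set G₂ : X → ℝ≥0∞ := fun x => g₂ x + T x
  have hG₁ : Measurable G₁ := hg₁.add hT
  have hG₂ : Measurable G₂ := hg₂.add hT
  set H : X → ℝ≥0∞ := S.piecewise G₁ G₂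
  set K : X → ℝ≥0∞ := S.piecewise G₂ G₁
  have hH : Measurable H := hG₁.piecewise hS hG₂
  have hK : Measurable K := hG₂.piecewise hS hG₁
  have htop : ∀ x ∉ M, T x = ⊤ := fun x hx => by simp [T, hx]
  have hzero : ∀ x ∈ M, T x = 0 := fun x hx => by simp [T, hx]
  have hHtop : ∀ x ∉ M, H x = ⊤ := fun x hx => by
    by_cases hxS : x ∈ S <;> simp [H, G₁, G₂, hxS, htop x hx]
  have hKtop : ∀ x ∉ M, K x = ⊤ := fun x hx => by
    by_cases hxS : x ∈ S <;> simp [K, G₁, G₂, hxS, htop x hx]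
  have hGf₁ : ∀ x ∈ M, G₁ x ≤ f x := fun x hx => by simp [G₁, f, hx, hzero x hx]
  have hGf₂ : ∀ x ∈ M, G₂ x ≤ f x := fun x hx => by simp [G₂, f, hx, hzero x hx]
  have hbound : ∀ G h : X → ℝ≥0∞, (∀ x ∈ M, G x ≤ f x) → (∀ x ∉ M, h x = ⊤) →
      ∀ x, G x ≤ f x + h x := by
    intro G h h1 h2 x
    by_cases hx : x ∈ M
    · exact (h1 x hx).trans le_self_add
    · simp [h2 x hx]
  have hW₁ : IsWeakUpperGradientOn μ p u G₁ U := hw₁.mono_gradient fun x => le_self_add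
  have hW₂ : IsWeakUpperGradientOn μ p v G₂ U := hw₂.mono_gradient fun x => le_self_add
  have hmax : IsWeakUpperGradientOn μ p (fun x => max (u x) (v x)) H U :=
    hW₁.max hp hG₁ hG₂ hW₂ hf hfin (hbound _ _ hGf₁ hHtop) (hbound _ _ hGf₂ hHtop)
      (fun x hx => piecewise_eq_of_mem _ _ _ hx)
      (fun x hx => piecewise_eq_of_notMem _ _ _ (not_le.2 hx))
  have hmin : IsWeakUpperGradientOn μ p (fun x => max (-u x) (-v x)) K U := by
    simp only [max_comm (-u _)]
    exact hW₂.neg.max hp hG₂ hG₁ hW₁.neg hf hfin (hbound _ _ hGf₂ hKtop)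
      (hbound _ _ hGf₁ hKtop)
      (fun x hx => piecewise_eq_of_mem _ _ _ (neg_le_neg_iff.1 hx))
      (fun x hx => piecewise_eq_of_notMem _ _ _ (not_le.2 (neg_lt_neg_iff.1 hx)))
  calc _ ≤ (∫⁻ x in V, H x ^ p ∂μ) + ∫⁻ x in V, K x ^ p ∂μ :=
        add_le_add (fineEnergy_le hH hmax V)
          (fineEnergy_le hK hmin V)
    _ = ∫⁻ x in M, (H x ^ p + K x ^ p) ∂μ := by
        rw [hMV, lintegral_add_left (hH.pow_const p)]
    _ = ∫⁻ x in M, (g₁ x ^ p + g₂ x ^ p) ∂μ := by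
        refine setLIntegral_congr_fun hM fun x hx => ?_
        by_cases hxS : x ∈ S
        · simp [H, K, G₁, G₂, hxS, hzero x hx]
        · simp [H, K, G₁, G₂, hxS, hzero x hx, add_comm]
    _ = _ := by rw [hMV, lintegral_add_left (hg₁.pow_const p)]

theorem DoublingMeasure.measure_lt_top_of_isBounded {μ : Measure X} (hd : DoublingMeasure μ)
    {V : Set X} (hV : Bornology.IsBounded V) : μ V < ⊤ := by
  rcases V.eq_empty_or_nonempty with rfl | ⟨x, -⟩
  · simp
  · obtain ⟨r, hr, hsub⟩ := hV.subset_ball_lt 0 x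
    exact (measure_mono hsub).trans_lt (hd.1 x r hr).2

/-- `u` is a fine minimizer in a quasiopen set `U` iff it is
both a fine subminimizer and a fine superminimizer in `U`. -/
theorem fineMinimizer_iff_sub_and_super {X : Type*} [MetricSpace X]
    [CompleteSpace X] [MeasurableSpace X] [BorelSpace X]
    (μ : Measure X) (p : ℝ) (hp : 1 < p)
    (hd : DoublingMeasure μ) (hPI : PoincareInequality μ p)
    (U : Set X) (hU : Quasiopen μ p U) (u : X → ℝ) :
    FineMinimizer μ p u U ↔
      FineSubminimizer μ p u U ∧ FineSuperminimizer μ p u U := by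
  have hp0 : 0 < p := zero_lt_one.trans hp
  constructor
  · rintro ⟨hloc, hmin⟩
    refine ⟨⟨fun V hV => (hloc V hV).neg hp0.le, fun V hV φ hφ _ => ?_⟩,
      hloc, fun V hV φ hφ _ => hmin V hV φ hφ⟩
    rw [fineEnergy_neg, ← fineEnergy_neg μ p fun x => -u x + φ x]
    simpa only [neg_add, neg_neg] using hmin V hV _ (hφ.neg hp0.le)
  · rintro ⟨⟨-, hsub⟩, hloc, hsup⟩
    refine ⟨hloc, fun V hV φ hφ => ?_⟩
    rcases eq_or_ne (fineEnergy μ p (fun x => u x + φ x) U V) ⊤ with htop | htop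
    · rw [htop]; exact le_top
    have hu : fineEnergy μ p u U V ≠ ⊤ := by
      have := fineEnergy_sub_lt_top hp.le hφ.1 htop.lt_top
      simpa only [add_sub_cancel_right] using this.ne
    have hVfin : μ V ≠ ⊤ :=
      (hd.measure_lt_top_of_isBounded (hV.2.2.1.isBounded.subset subset_closure)).ne
    have hS : MeasurableSet {x | u x ≤ u x + φ x} := by
      simpa only [le_add_iff_nonneg_right] using measurableSet_le measurable_const hφ.1.1
    have hmax := hsup V hV _ (hφ.max_zero hp0.le) fun x => le_max_right _ _
    have hmin := hsub V hV _ ((hφ.neg hp0.le).max_zero hp0.le) fun x => le_max_right _ _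
    rw [fineEnergy_neg, ← fineEnergy_neg μ p fun x => -u x + max (-φ x) 0] at hmin
    have e₁ : (fun x => u x + max (φ x) 0) = fun x => max (u x + φ x) (u x) := by
      funext x; rw [← max_add_add_left, add_zero]
    have e₂ : (fun x => -(-u x + max (-φ x) 0)) = fun x => min (u x + φ x) (u x) := by
      funext x
      rw [neg_add, neg_neg, ← min_neg_neg, neg_neg, neg_zero, ← min_add_add_left, add_zero]
    rw [e₁] at hmax
    rw [e₂] at hmin
    have key := (add_le_add hmax hmin).trans
      (fineEnergy_max_add_min_le (U := U) hp0 hVfin hS)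
    exact (ENNReal.add_le_add_iff_right hu).1 key
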